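/- Let d ∈ ℕ*, α ∈ (0,1), p ∈ (1,2] with q = p/(p−1), k ∈ (0,α), and m(x) := ⟨x⟩^k. Then there exist constants C > 0 and c > 0 such that for every u ∈ C_c^∞(ℝ^d) with u not identically zero: ∫_{ℝ^d} I(u)(x) u(x)^{p−1} m(x)^p dx ≤ C ‖u‖^p_{L^p(m)} − c ‖u‖_{L^p(m)}^{p + qα/d} ‖u‖_{L^1(m)}^{−qα/d}, where I(u)(x) := ∫ (u(y)−u(x))/|y−x|^{d+α} dy. -/

import Mathlib

open MeasureTheory

/-- Japanese bracket `⟨x⟩ = (1+|x|²)^{1/2}`. -/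
noncomputable def jb {d : ℕ} (x : EuclideanSpace ℝ (Fin d)) : ℝ := Real.sqrt (1 + ‖x‖ ^ 2)

/-- Signed power: `z ^ a := |z| ^ (a-1) * z`, with `0 ^ a = 0`. -/
noncomputable def sgnPow (a z : ℝ) : ℝ := |z| ^ (a - 1) * z

abbrev EE (d : ℕ) := EuclideanSpace ℝ (Fin d)

/-- radial majorant kernel -/
noncomputable def phiK (d : ℕ) (α k r : ℝ) : ℝ := min r (r ^ k) / r ^ ((d : ℝ) + α)

lemma one_le_jb {d : ℕ} (x : EE d) : 1 ≤ jb x := by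
  unfold jb
  rw [Real.one_le_sqrt]
  nlinarith [sq_nonneg ‖x‖]

lemma jb_lip {d : ℕ} (x y : EE d) : |jb x - jb y| ≤ ‖y - x‖ := by
  have hx := one_le_jb x
  have hy := one_le_jb y
  have h1 : jb x ^ 2 = 1 + ‖x‖ ^ 2 := Real.sq_sqrt (by positivity)
  have h2 : jb y ^ 2 = 1 + ‖y‖ ^ 2 := Real.sq_sqrt (by positivity)
  have h3 : ‖x‖ ≤ jb x := by
    exact abs_le_of_sq_le_sq' (by linarith) (by linarith) |>.2
  have h4 : ‖y‖ ≤ jb y := by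
    exact abs_le_of_sq_le_sq' (by linarith) (by linarith) |>.2
  have h5 : |‖x‖ - ‖y‖| ≤ ‖y - x‖ := by
    rw [norm_sub_rev]; exact abs_norm_sub_norm_le x y
  have h6 : (jb x - jb y) * (jb x + jb y) = (‖x‖ - ‖y‖) * (‖x‖ + ‖y‖) := by nlinarith
  have h7 : |jb x - jb y| * (jb x + jb y) = |‖x‖ - ‖y‖| * (‖x‖ + ‖y‖) := by
    have := congrArg abs h6
    rw [abs_mul, abs_mul, abs_of_pos (by linarith : 0 < jb x + jb y),
      abs_of_nonneg (by positivity : 0 ≤ ‖x‖ + ‖y‖)] at this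
    exact this
  have h8 : |jb x - jb y| * (jb x + jb y) ≤ ‖y - x‖ * (jb x + jb y) := by
    rw [h7]; gcongr
  exact le_of_mul_le_mul_right h8 (by linarith)

lemma rpow_diff_aux {s t k : ℝ} (ht : 1 ≤ t) (hst : t ≤ s) (hk : 0 < k) (hk1 : k < 1) :
    s ^ k - t ^ k ≤ s - t ∧ s ^ k - t ^ k ≤ (s - t) ^ k := by
  constructor
  · have h1 : (s / t) ^ k ≤ s / t := by
      have : 1 ≤ s / t := by rw [le_div_iff₀ (by linarith)]; linarith
      simpa using Real.rpow_le_rpow_of_exponent_le this hk1.le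
    rw [Real.div_rpow (by linarith) (by linarith)] at h1
    have htk : 1 ≤ t ^ k := Real.one_le_rpow ht hk.le
    have htk2 : t ^ k ≤ t := by simpa using Real.rpow_le_rpow_of_exponent_le ht hk1.le
    rw [div_le_div_iff₀ (by linarith) (by linarith)] at h1
    have : (s ^ k - t ^ k) * t ≤ (s - t) * t := by nlinarith
    exact le_of_mul_le_mul_right this (by linarith)
  · have := Real.rpow_add_le_add_rpow (a := s - t) (b := t) (by linarith) (by linarith) hk.le hk1.le
    rw [sub_add_cancel] at this
    linarith

lemma m_diff {d : ℕ} (x y : EE d) {k : ℝ} (hk : 0 < k) (hk1 : k < 1) :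
    |jb x ^ k - jb y ^ k| ≤ min ‖y - x‖ (‖y - x‖ ^ k) := by
  have key : ∀ x y : EE d, jb y ≤ jb x → |jb x ^ k - jb y ^ k| ≤ min ‖y - x‖ (‖y - x‖ ^ k) := by
    intro x y h
    have h0 := jb_lip x y
    rw [abs_of_nonneg (by linarith)] at h0
    have hm : jb y ^ k ≤ jb x ^ k := Real.rpow_le_rpow (by linarith [one_le_jb y]) h hk.le
    obtain ⟨a, b⟩ := rpow_diff_aux (one_le_jb y) h hk hk1
    rw [abs_of_nonneg (by linarith)]
    refine le_min (a.trans h0) (b.trans (Real.rpow_le_rpow (by linarith) h0 hk.le))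
  rcases le_total (jb y) (jb x) with h | h
  · exact key x y h
  · rw [abs_sub_comm, norm_sub_rev]; exact key y x h

lemma phiK_integrable {d : ℕ} (hd : 0 < d) {α k : ℝ} (hα : 0 < α ∧ α < 1) (hk : 0 < k ∧ k < α) :
    Integrable (fun z : EE d => phiK d α k ‖z‖) := by
  have : Nonempty (Fin d) := ⟨⟨0, hd⟩⟩
  have : Nontrivial (EE d) := inferInstance
  rw [integrable_fun_norm_addHaar (μ := (volume : Measure (EE d)))]
  have e : Module.finrank ℝ (EE d) = d := by simp
  rw [e, ← Set.Ioc_union_Ioi_eq_Ioi zero_le_one]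
  have pw : ∀ y : ℝ, 0 < y → ∀ a : ℝ, y ^ (d - 1) * (y ^ a / y ^ ((d : ℝ) + α)) = y ^ (a - 1 - α) := by
    intro y hy a
    rw [← Real.rpow_natCast, ← Real.rpow_sub hy, ← Real.rpow_add hy]
    congr 1
    rw [Nat.cast_sub hd]; push_cast; ring
  refine IntegrableOn.union ?_ ?_
  · have h1 : IntegrableOn (fun y : ℝ => y ^ (-α)) (Set.Ioc 0 1) := by
      have := (intervalIntegral.intervalIntegrable_rpow' (a := 0) (b := 1) (r := -α) (by linarith))
      rwa [intervalIntegrable_iff_integrableOn_Ioc_of_le zero_le_one] at this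
    refine h1.congr_fun ?_ measurableSet_Ioc
    intro y hy
    have : min y (y ^ k) = y := min_eq_left (by
      simpa using Real.rpow_le_rpow_of_exponent_ge hy.1 hy.2 (by linarith : k ≤ 1))
    have h2 := pw y hy.1 1
    simp only [phiK, this, smul_eq_mul]
    rw [Real.rpow_one] at h2
    rw [h2]; congr 1; ring
  · have h1 : IntegrableOn (fun y : ℝ => y ^ (k - 1 - α)) (Set.Ioi 1) :=
      integrableOn_Ioi_rpow_of_lt (by linarith) one_pos
    refine h1.congr_fun ?_ measurableSet_Ioi
    intro y hy
    have hy' : 1 < y := hy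
    have : min y (y ^ k) = y ^ k := min_eq_right (by
      simpa using Real.rpow_le_rpow_of_exponent_le hy'.le (by linarith : k ≤ 1))
    simp only [phiK, this, smul_eq_mul]
    rw [pw y (by linarith)]

lemma conv_int {d : ℕ} {g h : EE d → ℝ} (hg : Integrable g) (hh : Integrable h) :
    Integrable (fun z : EE d × EE d => g z.1 * h (z.2 - z.1)) (volume.prod volume) ∧
    ∫ z : EE d × EE d, g z.1 * h (z.2 - z.1) ∂(volume.prod volume) = (∫ x, g x) * ∫ x, h x := by
  have mp := measurePreserving_prod_sub (volume : Measure (EE d)) (volume : Measure (EE d))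
  have me : MeasurableEmbedding (fun z : EE d × EE d => (z.1, z.2 - z.1)) :=
    (MeasurableEquiv.shearSubRight (EE d)).measurableEmbedding
  constructor
  · exact mp.integrable_comp_of_integrable (hg.mul_prod hh)
  · rw [← integral_prod_mul]
    exact mp.integral_comp me (fun z => g z.1 * h z.2)

lemma conv_int' {d : ℕ} {g h : EE d → ℝ} (hg : Integrable g) (hh : Integrable h)
    (hs : ∀ z, h (-z) = h z) :
    Integrable (fun z : EE d × EE d => g z.2 * h (z.2 - z.1)) (volume.prod volume) ∧
    ∫ z : EE d × EE d, g z.2 * h (z.2 - z.1) ∂(volume.prod volume) = (∫ x, g x) * ∫ x, h x := by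
  obtain ⟨a, b⟩ := conv_int hg hh
  have e : (fun z : EE d × EE d => g z.2 * h (z.2 - z.1)) =
      fun z => (fun z : EE d × EE d => g z.1 * h (z.2 - z.1)) z.swap := by
    funext z
    simp only [Prod.fst_swap, Prod.snd_swap]
    rw [← hs (z.2 - z.1), neg_sub]
  rw [e]
  constructor
  · exact a.swap
  · exact (integral_prod_swap (fun z : EE d × EE d => g z.1 * h (z.2 - z.1))).trans b

lemma abs_sgnPow {a z : ℝ} (ha : 0 < a) : |sgnPow a z| = |z| ^ a := by
  unfold sgnPow
  by_cases h : z = 0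
  · subst h; simp [Real.zero_rpow ha.ne']
  · have : 0 < |z| := abs_pos.2 h
    rw [abs_mul, abs_of_nonneg (by positivity)]
    conv_lhs => rw [← Real.rpow_one |z|, ← Real.rpow_mul this.le, ← Real.rpow_add this]
    ring_nf

lemma mul_sgnPow {a z : ℝ} (ha : 0 < a) : z * sgnPow a z = |z| ^ (a + 1) := by
  unfold sgnPow
  by_cases h : z = 0
  · subst h; simp [Real.zero_rpow (by linarith : a + 1 ≠ 0)]
  · have : 0 < |z| := abs_pos.2 h
    rw [show z * (|z| ^ (a - 1) * z) = |z| ^ (a - 1) * (|z| * |z|) by rw [abs_mul_abs_self]; ring]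
    rw [show a + 1 = (a - 1) + 1 + 1 by ring, Real.rpow_add_one this.ne', Real.rpow_add_one this.ne']
    ring

lemma sgnPow_mono {a s t : ℝ} (ha : 0 < a) : 0 ≤ (s - t) * (sgnPow a s - sgnPow a t) := by
  have e : (s - t) * (sgnPow a s - sgnPow a t) =
    |s| ^ (a+1) + |t| ^ (a+1) - s * sgnPow a t - t * sgnPow a s := by
    rw [← mul_sgnPow ha, ← mul_sgnPow ha]; ring
  have h1 : s * sgnPow a t ≤ |s| * |t| ^ a := by
    rw [← abs_sgnPow ha, ← abs_mul]; exact le_abs_self _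
  have h2 : t * sgnPow a s ≤ |t| * |s| ^ a := by
    rw [← abs_sgnPow ha, ← abs_mul]; exact le_abs_self _
  have e1 : ∀ s : ℝ, |s| ^ (a+1) = |s| ^ a * |s| := fun s =>
    Real.rpow_add_one' (abs_nonneg _) (by linarith)
  have h3 : 0 ≤ (|s| - |t|) * (|s| ^ a - |t| ^ a) := by
    rcases le_total |s| |t| with h | h
    · have := Real.rpow_le_rpow (abs_nonneg s) h ha.le
      nlinarith
    · have := Real.rpow_le_rpow (abs_nonneg t) h ha.le
      nlinarith
  rw [e, e1, e1]; nlinarith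

lemma young_easy {a s t : ℝ} (ha : 0 < a) (hs : 0 ≤ s) (ht : 0 ≤ t) :
    t * s ^ a ≤ s ^ (a + 1) + t ^ (a + 1) := by
  rw [Real.rpow_add_one' hs (by linarith), Real.rpow_add_one' ht (by linarith)]
  have := Real.rpow_nonneg hs a
  have := Real.rpow_nonneg ht a
  rcases le_total s t with h | h
  · have := Real.rpow_le_rpow hs h ha.le
    nlinarith
  · nlinarith

lemma young_scale {a s l : ℝ} (ha : 0 < a) (hs : 0 ≤ s) (hl : 0 < l) :
    s ^ a ≤ l * s ^ (a + 1) + l ^ (-a) := by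
  have h0 := Real.rpow_nonneg hs a
  rw [Real.rpow_add_one' hs (by linarith)]
  have h1 := Real.rpow_pos_of_pos hl (-a)
  rcases le_total 1 (l * s) with h | h
  · nlinarith
  · have : s ≤ l⁻¹ := by rw [← one_div, le_div_iff₀ hl]; linarith
    have h2 := Real.rpow_le_rpow hs this ha.le
    rw [Real.inv_rpow hl.le, ← Real.rpow_neg hl.le] at h2
    have : 0 ≤ l * (s ^ a * s) := by positivity
    linarith
/-- indicator of a ball -/
noncomputable def indB (d : ℕ) (r : ℝ) (z : EE d) : ℝ := (Metric.ball (0 : EE d) r).indicator 1 z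

lemma indB_integrable {d : ℕ} (r : ℝ) : Integrable (indB d r) := by
  unfold indB
  exact (integrable_indicator_iff measurableSet_ball).2
    (integrableOn_const measure_ball_lt_top.ne)

lemma indB_integral {d : ℕ} (r : ℝ) (hr : 0 < r) :
    ∫ z, indB d r z = r ^ d * (volume : Measure (EE d)).real (Metric.ball 0 1) := by
  unfold indB
  rw [integral_indicator_one measurableSet_ball, measureReal_def, Measure.addHaar_ball_of_pos _ _ hr,
    ENNReal.toReal_mul, ENNReal.toReal_ofReal (by positivity), measureReal_def]
  simp

lemma indB_nonneg {d : ℕ} (r : ℝ) (z : EE d) : 0 ≤ indB d r z := by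
  unfold indB; exact Set.indicator_nonneg (by simp) _

lemma indB_le_one {d : ℕ} (r : ℝ) (z : EE d) : indB d r z ≤ 1 := by
  unfold indB; exact Set.indicator_le_self' (by simp) _

lemma indB_neg {d : ℕ} (r : ℝ) (z : EE d) : indB d r (-z) = indB d r z := by
  unfold indB; simp [Set.indicator]

lemma indB_kernel {d : ℕ} {r β : ℝ} (hr : 0 < r) (hβ : 0 < β) (z : EE d) (hz : z ≠ 0) :
    (r ^ β)⁻¹ * indB d r z ≤ (‖z‖ ^ β)⁻¹ := by
  have hz' : 0 < ‖z‖ := norm_pos_iff.2 hz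
  by_cases h : ‖z‖ < r
  · have : indB d r z = 1 := by unfold indB; simp [Set.indicator, h]
    rw [this, mul_one]
    gcongr
  · have : indB d r z = 0 := by unfold indB; simp [Set.indicator, h]
    rw [this, mul_zero]; positivity

lemma nash_core {d : ℕ} {β a r l : ℝ} (ha : 0 < a) (hβ : 0 < β) (hr : 0 < r) (hl : 0 < l)
    {f : EE d → ℝ} (hf : Integrable f) (hfm : Measurable f) (hfp : Integrable fun x => |f x| ^ (a + 1))
    (hfa : Integrable fun x => |f x| ^ a)
    (hK : Integrable (fun z : EE d × EE d =>
      (f z.1 - f z.2) * sgnPow a (f z.1) * (‖z.2 - z.1‖ ^ β)⁻¹) (volume.prod volume)) :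
    (r ^ β)⁻¹ * ((∫ x, |f x| ^ (a + 1)) * (∫ z, indB d r z) - l * ((∫ x, |f x| ^ (a + 1)) * ∫ x, |f x|)
        - l ^ (-a) * ((∫ x, |f x|) * ∫ z, indB d r z)) ≤
      ∫ z : EE d × EE d,
      (f z.1 - f z.2) * sgnPow a (f z.1) * (‖z.2 - z.1‖ ^ β)⁻¹ ∂(volume.prod volume) := by
  set ρ := (r ^ β)⁻¹ with hρ
  have hρ0 : 0 < ρ := by positivity
  have hs : Measurable (sgnPow a) := by unfold sgnPow; fun_prop
  have hB : Measurable (indB d r) := by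
    unfold indB; exact measurable_one.indicator measurableSet_ball
  obtain ⟨i1, e1⟩ := conv_int hfp (indB_integrable (d := d) r)
  obtain ⟨i2, e2⟩ := conv_int' hf.abs (indB_integrable (d := d) r) (indB_neg r)
  have i3 : Integrable (fun z : EE d × EE d => |f z.1| ^ (a+1) * |f z.2|) (volume.prod volume) :=
    hfp.mul_prod hf.abs
  have e3 : ∫ z : EE d × EE d, |f z.1| ^ (a+1) * |f z.2| ∂(volume.prod volume) = _ :=
    integral_prod_mul (fun x => |f x| ^ (a+1)) (fun x => |f x|)
  have i4 : Integrable (fun z : EE d × EE d => |f z.1| ^ a * |f z.2|) (volume.prod volume) :=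
    hfa.mul_prod hf.abs
  set D : EE d × EE d → ℝ := fun z => (f z.1 - f z.2) * sgnPow a (f z.1) with hD
  have hDm : Measurable D := by
    rw [hD]; fun_prop
  have iB : Integrable (fun z : EE d × EE d => D z * (ρ * indB d r (z.2 - z.1)))
      (volume.prod volume) := by
    have hb := (i1.add i4).const_mul ρ
    refine hb.mono' ?_ ?_
    · apply Measurable.aestronglyMeasurable; fun_prop
    · filter_upwards with z
      have b0 := indB_nonneg r (z.2 - z.1)
      have b1 := indB_le_one r (z.2 - z.1)
      have hD' : |D z| ≤ |f z.1| ^ (a+1) + |f z.1| ^ a * |f z.2| := by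
        have : D z = f z.1 * sgnPow a (f z.1) - f z.2 * sgnPow a (f z.1) := by rw [hD]; ring
        rw [this, mul_sgnPow ha]
        refine (abs_sub _ _).trans ?_
        rw [abs_mul, abs_sgnPow ha, abs_of_nonneg (by positivity : 0 ≤ |f z.1| ^ (a+1))]
        linarith
      have hX : 0 ≤ |f z.1| ^ a * |f z.2| := by positivity
      simp only [Pi.add_apply, Real.norm_eq_abs, abs_mul, abs_of_pos hρ0, abs_of_nonneg b0]
      have : |D z| * indB d r (z.2 - z.1) ≤ (|f z.1| ^ (a+1) + |f z.1| ^ a * |f z.2|) * indB d r (z.2 - z.1) := by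
        gcongr
      have h7 : (|f z.1| ^ a * |f z.2|) * indB d r (z.2 - z.1) ≤ |f z.1| ^ a * |f z.2| :=
        mul_le_of_le_one_right hX b1
      have h8 : |D z| * indB d r (z.2 - z.1) ≤
          |f z.1| ^ (a+1) * indB d r (z.2 - z.1) + |f z.1| ^ a * |f z.2| := by linarith
      have h9 := mul_le_mul_of_nonneg_left h8 hρ0.le
      linarith
  have iR := hK.sub iB
  -- symmetric remainder is nonnegative
  set R : EE d × EE d → ℝ := fun z => D z * ((‖z.2 - z.1‖ ^ β)⁻¹ - ρ * indB d r (z.2 - z.1)) with hR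
  have iR' : Integrable R (volume.prod volume) := by
    refine iR.congr ?_
    filter_upwards with z
    simp only [hR, hD, Pi.sub_apply]; ring
  have hRs : 0 ≤ ∫ z, R z ∂(volume.prod volume) := by
    have h1 : ∫ z : EE d × EE d, R z.swap ∂(volume.prod volume) = ∫ z, R z ∂(volume.prod volume) :=
      integral_prod_swap R
    have h2 : 0 ≤ ∫ z : EE d × EE d, (R z + R z.swap) ∂(volume.prod volume) := by
      apply integral_nonneg
      intro z
      have e : R z + R z.swap = (f z.1 - f z.2) * (sgnPow a (f z.1) - sgnPow a (f z.2)) *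
          ((‖z.2 - z.1‖ ^ β)⁻¹ - ρ * indB d r (z.2 - z.1)) := by
        simp only [hR, hD, Prod.fst_swap, Prod.snd_swap]
        rw [← neg_sub z.2 z.1, norm_neg, indB_neg]; ring
      show 0 ≤ R z + R z.swap
      rw [e]
      by_cases hz : z.2 - z.1 = 0
      · have : z.2 = z.1 := sub_eq_zero.1 hz
        simp [this]
      · exact mul_nonneg (sgnPow_mono ha) (sub_nonneg.2 (indB_kernel hr hβ _ hz))
    have h3 : ∫ z : EE d × EE d, (R z + R z.swap) ∂(volume.prod volume) = _ :=
      integral_add iR' iR'.swap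
    rw [h3] at h2
    rw [h1] at h2
    linarith
  have split : ∫ z : EE d × EE d, D z * (‖z.2 - z.1‖ ^ β)⁻¹ ∂(volume.prod volume) =
      ∫ z, R z ∂(volume.prod volume) +
        ∫ z : EE d × EE d, D z * (ρ * indB d r (z.2 - z.1)) ∂(volume.prod volume) := by
    rw [← integral_add iR' iB]
    congr 1; funext z; simp only [hR]; ring
  rw [split]
  have low : ∫ z : EE d × EE d, ρ * (|f z.1| ^ (a + 1) * indB d r (z.2 - z.1) -
      l * (|f z.1| ^ (a+1) * |f z.2|) - l ^ (-a) * (|f z.2| * indB d r (z.2 - z.1))) ∂(volume.prod volume)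
      ≤ ∫ z : EE d × EE d, D z * (ρ * indB d r (z.2 - z.1)) ∂(volume.prod volume) := by
    refine integral_mono (((i1.sub (i3.const_mul l)).sub (i2.const_mul _)).const_mul ρ) iB ?_
    intro z
    have b0 := indB_nonneg r (z.2 - z.1)
    have b1 := indB_le_one r (z.2 - z.1)
    have h1 : D z = |f z.1| ^ (a+1) - f z.2 * sgnPow a (f z.1) := by
      rw [← mul_sgnPow ha, hD]; ring
    have h2 : f z.2 * sgnPow a (f z.1) ≤ |f z.2| * (l * |f z.1| ^ (a + 1) + l ^ (-a)) := by
      refine (le_abs_self _).trans ?_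
      rw [abs_mul, abs_sgnPow ha]
      gcongr
      exact young_scale ha (abs_nonneg _) hl
    show ρ * (_) ≤ D z * (ρ * indB d r (z.2 - z.1))
    rw [show D z * (ρ * indB d r (z.2 - z.1)) = ρ * (D z * indB d r (z.2 - z.1)) by ring]
    refine mul_le_mul_of_nonneg_left ?_ hρ0.le
    rw [h1]
    have h3 := mul_le_mul_of_nonneg_right h2 b0
    have h4 : l * (|f z.1| ^ (a+1) * |f z.2|) * indB d r (z.2 - z.1) ≤ l * (|f z.1| ^ (a+1) * |f z.2|) :=
      mul_le_of_le_one_right (by positivity) b1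
    linarith
  have i5 : Integrable (fun z : EE d × EE d => |f z.1| ^ (a + 1) * indB d r (z.2 - z.1) -
      l * (|f z.1| ^ (a+1) * |f z.2|)) (volume.prod volume) := i1.sub (i3.const_mul l)
  rw [integral_const_mul, integral_sub i5 (i2.const_mul _),
    integral_sub i1 (i3.const_mul l), integral_const_mul, integral_const_mul, e1, e2, e3] at low
  linarith

lemma alg_final {d : ℕ} (hd : 0 < d) {α p q P B ω : ℝ} (hα : 0 < α) (hp : 1 < p)
    (hq : q = p / (p - 1)) (hP : 0 < P) (hB : 0 < B) (hω : 0 < ω) :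
    ∃ r l : ℝ, 0 < r ∧ 0 < l ∧
      (ω ^ (1 + α / d) * 4 ^ (-(q * α / d)) / 2) * (P ^ (1 / p)) ^ (p + q * α / d) * B ^ (-(q * α / d)) =
      (r ^ ((d : ℝ) + α))⁻¹ * (P * (r ^ d * ω) - l * (P * B) - l ^ (-(p - 1)) * (B * (r ^ d * ω))) := by
  have hp1 : 0 < p - 1 := by linarith
  have hd' : (0 : ℝ) < d := by exact_mod_cast hd
  set V : ℝ := (4 * B) ^ q * P ^ (-(1 / (p - 1))) with hV
  have hV0 : 0 < V := by positivity
  set r : ℝ := (V / ω) ^ (1 / (d : ℝ)) with hr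
  have hr0 : 0 < r := by positivity
  have hrd : r ^ d * ω = V := by
    rw [hr, ← Real.rpow_natCast, ← Real.rpow_mul (by positivity), one_div_mul_cancel hd'.ne',
      Real.rpow_one]
    field_simp
  have hl0 : 0 < V / (4 * B) := by positivity
  refine ⟨r, V / (4 * B), hr0, hl0, ?_⟩
  rw [hrd]
  have hqp : q * (p - 1) = p := by rw [hq]; field_simp
  have hVp : V ^ (p - 1) = (4 * B) ^ p / P := by
    rw [hV, Real.mul_rpow (by positivity) (by positivity), ← Real.rpow_mul (by positivity),
      ← Real.rpow_mul hP.le, hqp, show -(1 / (p - 1)) * (p - 1) = -1 by field_simp, Real.rpow_neg_one]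
    rfl
  have h1 : (V / (4 * B)) ^ (-(p - 1)) = P / (4 * B) := by
    rw [Real.rpow_neg hl0.le, Real.div_rpow hV0.le (by positivity), hVp, Real.rpow_sub_one (by positivity)]
    have : (0:ℝ) < (4 * B) ^ p := by positivity
    field_simp
  rw [h1]
  have h2 : P * V - V / (4 * B) * (P * B) - P / (4 * B) * (B * V) = P * V / 2 := by
    field_simp; ring
  rw [h2]
  have h3 : r ^ ((d : ℝ) + α) = (V / ω) ^ (1 + α / d) := by
    rw [hr, ← Real.rpow_mul (by positivity)]; congr 1; field_simp
  have h4 : V ^ (-(α / d)) = 4 ^ (-(q * α / d)) * B ^ (-(q * α / d)) * P ^ (α / (d * (p - 1))) := by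
    rw [hV, Real.mul_rpow (by positivity) (by positivity), ← Real.rpow_mul (by positivity),
      ← Real.rpow_mul hP.le, Real.mul_rpow (by positivity) hB.le]
    rw [show q * -(α / d) = -(q * α / d) by ring,
      show -(1 / (p - 1)) * -(α / d) = α / (d * (p - 1)) by field_simp]
  have h5 : (P ^ (1 / p)) ^ (p + q * α / d) = P * P ^ (α / (d * (p - 1))) := by
    rw [← Real.rpow_mul hP.le, ← Real.rpow_one_add' hP.le (by positivity)]
    congr 1
    rw [hq]; field_simp
  have h6 : ((V / ω) ^ (1 + α / d))⁻¹ * V = ω ^ (1 + α / d) * V ^ (-(α / d)) := by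
    rw [Real.div_rpow hV0.le hω.le, Real.rpow_add hV0, Real.rpow_one, Real.rpow_neg hV0.le]
    have : 0 < V ^ (α / d) := by positivity
    field_simp
  rw [h3, show ((V / ω) ^ (1 + α / d))⁻¹ * (P * V / 2) = (((V / ω) ^ (1 + α / d))⁻¹ * V) * P / 2 by ring,
    h6, h4, h5]
  ring
lemma sgnPow_mul {p v m : ℝ} (hm : 0 < m) :
    sgnPow (p - 1) v * m ^ p = sgnPow (p - 1) (v * m) * m := by
  unfold sgnPow
  rw [abs_mul, abs_of_pos hm, Real.mul_rpow (abs_nonneg _) hm.le,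
    show m ^ p = m ^ (p - 1 - 1) * m * m by
      rw [← Real.rpow_add_one hm.ne', ← Real.rpow_add_one hm.ne']; ring_nf]
  ring

lemma u_diff {d : ℕ} {u : EE d → ℝ} (hu : ContDiff ℝ (⊤ : ℕ∞) u) (hc : HasCompactSupport u)
    {k : ℝ} (hk : 0 < k) (hk1 : k < 1) :
    ∃ L : ℝ, 0 ≤ L ∧ ∀ x y, |u y - u x| ≤ L * min ‖y - x‖ (‖y - x‖ ^ k) := by
  obtain ⟨L, hL⟩ := ContDiff.lipschitzWith_of_hasCompactSupport hc hu (by simp)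
  obtain ⟨M, hM⟩ := hc.exists_bound_of_continuous hu.continuous
  have hM0 : 0 ≤ M := (norm_nonneg _).trans (hM 0)
  refine ⟨L + 2 * M, by positivity, fun x y => ?_⟩
  have h1 : |u y - u x| ≤ L * ‖y - x‖ := by
    simpa [Real.dist_eq, dist_eq_norm] using hL.dist_le_mul y x
  have h2 : |u y - u x| ≤ 2 * M := by
    have a := hM x
    have b := hM y
    rw [Real.norm_eq_abs] at a b
    have := abs_sub (u y) (u x)
    linarith
  have hL0 : (0:ℝ) ≤ L := L.2
  rcases le_total ‖y - x‖ 1 with h | h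
  · have : min ‖y - x‖ (‖y - x‖ ^ k) = ‖y - x‖ := min_eq_left (by
      rcases (norm_nonneg (y - x)).eq_or_lt with h0 | h0
      · rw [← h0]; positivity
      · simpa using Real.rpow_le_rpow_of_exponent_ge h0 h hk1.le)
    rw [this]
    have := norm_nonneg (y - x)
    nlinarith
  · have : 1 ≤ min ‖y - x‖ (‖y - x‖ ^ k) := le_min h (Real.one_le_rpow h hk.le)
    nlinarith

theorem stmt13 (d : ℕ) (hd : 0 < d) (α p q k : ℝ) (hα : 0 < α ∧ α < 1)
    (hp : 1 < p ∧ p ≤ 2) (hq : q = p / (p - 1)) (hk : 0 < k ∧ k < α) :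
    ∃ C c : ℝ, 0 < C ∧ 0 < c ∧
      ∀ u : EuclideanSpace ℝ (Fin d) → ℝ, ContDiff ℝ (⊤ : ℕ∞) u → HasCompactSupport u → u ≠ 0 →
      (∫ x : EuclideanSpace ℝ (Fin d),
          (∫ y : EuclideanSpace ℝ (Fin d), (u y - u x) / ‖y - x‖ ^ ((d : ℝ) + α)) *
            sgnPow (p - 1) (u x) * (jb x ^ k) ^ p) ≤
        C * (∫ x : EuclideanSpace ℝ (Fin d), (|u x| * jb x ^ k) ^ p) -
        c * ((∫ x : EuclideanSpace ℝ (Fin d), (|u x| * jb x ^ k) ^ p) ^ (1 / p)) ^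
            (p + q * α / d) *
          (∫ x : EuclideanSpace ℝ (Fin d), |u x| * jb x ^ k) ^ (-(q * α / d)) := by
  have hk1 : k < 1 := by linarith
  have hp1 : 0 < p - 1 := by linarith
  have hβ : 0 < (d : ℝ) + α := by have := hα.1; positivity
  set Φ : ℝ := ∫ z : EE d, phiK d α k ‖z‖ with hΦ
  have hφ := phiK_integrable hd hα hk
  have hφ0 : ∀ z : EE d, 0 ≤ phiK d α k ‖z‖ := fun z => by unfold phiK; positivity
  have hφm : Measurable (fun z : EE d => phiK d α k ‖z‖) := by unfold phiK; fun_prop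
  have hΦ0 : 0 ≤ Φ := integral_nonneg hφ0
  set ω : ℝ := (volume : Measure (EE d)).real (Metric.ball 0 1) with hω
  have hω0 : 0 < ω := by
    rw [hω, measureReal_def]
    exact ENNReal.toReal_pos (Metric.measure_ball_pos _ _ one_pos).ne' measure_ball_lt_top.ne
  refine ⟨2 * Φ + 1, ω ^ (1 + α / d) * 4 ^ (-(q * α / d)) / 2, by linarith, by positivity, ?_⟩
  intro u hu hc hu0
  have huc := hu.continuous
  have jbc : Continuous (fun x : EE d => jb x) := by unfold jb; fun_prop
  set m : EE d → ℝ := fun x => jb x ^ k with hm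
  have hm1 : ∀ x, 1 ≤ m x := fun x => Real.one_le_rpow (one_le_jb x) hk.1.le
  have hm0 : ∀ x, 0 < m x := fun x => by linarith [hm1 x]
  have hmc : Continuous m := jbc.rpow_const (fun x => Or.inr hk.1.le)
  set f : EE d → ℝ := fun x => u x * m x with hf
  have hfc : Continuous f := huc.mul hmc
  have hfs : HasCompactSupport f := hc.mul_right
  have habs : ∀ x, |u x| * m x = |f x| := fun x => by
    rw [hf]; simp only [abs_mul, abs_of_pos (hm0 x)]
  have hpa : ∀ a : ℝ, 0 < a → Continuous (fun x => |f x| ^ a) ∧ HasCompactSupport (fun x => |f x| ^ a) := by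
    intro a ha
    refine ⟨hfc.abs.rpow_const (fun x => Or.inr ha.le), ?_⟩
    exact hfs.comp_left (g := fun t : ℝ => |t| ^ a) (by simp [Real.zero_rpow ha.ne'])
  have ipa : ∀ a : ℝ, 0 < a → Integrable (fun x => |f x| ^ a) := fun a ha =>
    (hpa a ha).1.integrable_of_hasCompactSupport (hpa a ha).2
  have if1 : Integrable f := hfc.integrable_of_hasCompactSupport hfs
  obtain ⟨x0, hx0⟩ : ∃ x, f x ≠ 0 := by
    obtain ⟨x, hx⟩ := Function.ne_iff.1 hu0
    exact ⟨x, mul_ne_zero hx (hm0 x).ne'⟩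
  set P : ℝ := ∫ x, |f x| ^ p with hP
  set B : ℝ := ∫ x, |f x| with hB
  have hP0 : 0 < P := by
    refine Continuous.integral_pos_of_hasCompactSupport_nonneg_nonzero (x := x0) (hpa p (by linarith)).1
      (hpa p (by linarith)).2 (fun x => by positivity) ?_
    have := abs_pos.2 hx0
    positivity
  have hB0 : 0 < B :=
    Continuous.integral_pos_of_hasCompactSupport_nonneg_nonzero (x := x0) hfc.abs
      hfs.norm (fun x => by positivity) (abs_ne_zero.2 hx0)
  have hPe : (∫ x : EE d, (|u x| * jb x ^ k) ^ p) = P := by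
    rw [hP]; congr 1; funext x; exact congrArg (· ^ p) (habs x)
  have hBe : (∫ x : EE d, |u x| * jb x ^ k) = B := by
    rw [hB]; congr 1; funext x; exact habs x
  rw [hPe, hBe]
  have hsm : Measurable (sgnPow (p - 1)) := by unfold sgnPow; fun_prop
  have hfm := hfc.measurable
  have hum := huc.measurable
  have hmm := hmc.measurable
  set w : EE d → ℝ := fun x => sgnPow (p - 1) (f x) with hw
  have hwm : Measurable w := hsm.comp hfm
  have hwa : ∀ x, |w x| = |f x| ^ (p - 1) := fun x => abs_sgnPow hp1
  -- the three integrands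
  set G : EE d × EE d → ℝ := fun z =>
    (u z.2 - u z.1) / ‖z.2 - z.1‖ ^ ((d : ℝ) + α) * (w z.1 * m z.1) with hG
  set G2 : EE d × EE d → ℝ := fun z =>
    f z.2 * ((m z.1 - m z.2) / m z.2) * w z.1 * (‖z.2 - z.1‖ ^ ((d : ℝ) + α))⁻¹ with hG2
  have hGm : Measurable G := by rw [hG]; fun_prop
  have hG2m : Measurable G2 := by rw [hG2]; fun_prop
  have hdec : ∀ z, (f z.1 - f z.2) * sgnPow (p - 1) (f z.1) * (‖z.2 - z.1‖ ^ ((d : ℝ) + α))⁻¹ =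
      G2 z - G z := by
    intro z
    simp only [hG, hG2, hf, hw]
    have := (hm0 z.2).ne'
    field_simp
    ring
  obtain ⟨L, hL0, hL⟩ := u_diff hu hc hk.1 hk1
  have hwm_int : Integrable (fun x => |f x| ^ (p - 1) * m x) :=
    ((hpa _ hp1).1.mul hmc).integrable_of_hasCompactSupport (hpa _ hp1).2.mul_right
  have iG : Integrable G (volume.prod volume) := by
    refine ((conv_int hwm_int hφ).1.const_mul L).mono' hGm.aestronglyMeasurable ?_
    filter_upwards with z
    have h1 := hL z.1 z.2
    simp only [hG, Real.norm_eq_abs, abs_mul, abs_div, hwa, abs_of_pos (hm0 z.1)]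
    rw [abs_of_nonneg (by positivity : 0 ≤ ‖z.2 - z.1‖ ^ ((d : ℝ) + α))]
    unfold phiK
    calc |u z.2 - u z.1| / ‖z.2 - z.1‖ ^ ((d : ℝ) + α) * (|f z.1| ^ (p - 1) * m z.1)
        ≤ (L * min ‖z.2 - z.1‖ (‖z.2 - z.1‖ ^ k)) / ‖z.2 - z.1‖ ^ ((d : ℝ) + α)
          * (|f z.1| ^ (p - 1) * m z.1) := by
          have := (hm0 z.1).le
          gcongr
      _ = _ := by ring
  obtain ⟨j1, s1⟩ := conv_int (ipa p (by linarith)) hφ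
  obtain ⟨j2, s2⟩ := conv_int' (ipa p (by linarith)) hφ (fun z => by rw [norm_neg])
  have bG2 : ∀ z, ‖G2 z‖ ≤ |f z.1| ^ p * phiK d α k ‖z.2 - z.1‖ + |f z.2| ^ p * phiK d α k ‖z.2 - z.1‖ := by
    intro z
    have h1 := m_diff z.1 z.2 hk.1 hk1
    have h2 : |m z.1 - m z.2| / m z.2 ≤ min ‖z.2 - z.1‖ (‖z.2 - z.1‖ ^ k) :=
      (div_le_self (abs_nonneg _) (hm1 _)).trans h1
    have h3 := young_easy hp1 (abs_nonneg (f z.1)) (abs_nonneg (f z.2))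
    rw [sub_add_cancel] at h3
    simp only [hG2, Real.norm_eq_abs, abs_mul, abs_div, hwa, abs_of_pos (hm0 z.2), abs_inv]
    rw [abs_of_nonneg (by positivity : 0 ≤ ‖z.2 - z.1‖ ^ ((d : ℝ) + α))]
    calc |f z.2| * (|m z.1 - m z.2| / m z.2) * |f z.1| ^ (p - 1) * (‖z.2 - z.1‖ ^ ((d : ℝ) + α))⁻¹
        ≤ |f z.2| * min ‖z.2 - z.1‖ (‖z.2 - z.1‖ ^ k) * |f z.1| ^ (p - 1)
          * (‖z.2 - z.1‖ ^ ((d : ℝ) + α))⁻¹ := by gcongr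
      _ = (|f z.2| * |f z.1| ^ (p - 1)) * phiK d α k ‖z.2 - z.1‖ := by unfold phiK; ring
      _ ≤ (|f z.1| ^ p + |f z.2| ^ p) * phiK d α k ‖z.2 - z.1‖ :=
          mul_le_mul_of_nonneg_right h3 (hφ0 _)
      _ = _ := by ring
  have iG2 : Integrable G2 (volume.prod volume) := by
    refine (j1.add j2).mono' hG2m.aestronglyMeasurable ?_
    filter_upwards with z
    exact bG2 z
  have hG2le : ∫ z, G2 z ∂(volume.prod volume) ≤ 2 * Φ * P := by
    have h1 : ∫ z, G2 z ∂(volume.prod volume) ≤ ∫ z : EE d × EE d,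
        (|f z.1| ^ p * phiK d α k ‖z.2 - z.1‖ + |f z.2| ^ p * phiK d α k ‖z.2 - z.1‖)
          ∂(volume.prod volume) :=
      integral_mono iG2 (j1.add j2) (fun z => (le_abs_self _).trans (bG2 z))
    rw [integral_add j1 j2, s1, s2] at h1
    linarith
  have hLHS : (∫ x : EE d, (∫ y : EE d, (u y - u x) / ‖y - x‖ ^ ((d : ℝ) + α)) *
            sgnPow (p - 1) (u x) * (jb x ^ k) ^ p) = ∫ z, G z ∂(volume.prod volume) := by
    rw [integral_prod _ iG]
    congr 1; funext x
    rw [mul_assoc, ← integral_mul_const, sgnPow_mul (hm0 x)]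
  obtain ⟨r, l, hr0, hl0, hrl⟩ := alg_final hd hα.1 hp.1 hq hP0 hB0 hω0
  have iD : Integrable (fun z : EE d × EE d =>
      (f z.1 - f z.2) * sgnPow (p - 1) (f z.1) * (‖z.2 - z.1‖ ^ ((d : ℝ) + α))⁻¹)
      (volume.prod volume) := by
    simp_rw [hdec]; exact iG2.sub iG
  have hN := nash_core hp1 hβ hr0 hl0 if1 hfm (by rw [sub_add_cancel]; exact ipa p (by linarith))
    (ipa _ hp1) iD
  simp_rw [hdec] at hN
  rw [integral_sub iG2 iG, indB_integral r hr0, sub_add_cancel, ← hrl] at hN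
  rw [hLHS]
  nlinarith
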